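/- arXiv:1909.09958 — 3 statements merged into one kernel-verified Lean document; each statement's English description precedes it below -/
import Mathlib

section
/- Let 0 < p ≤ 1 and let f, g belong to L₁(K₀(px)dx). Then the Kontorovich–Lebedev convolution f∗g belongs to L₁(K₀(p²x)dx) and satisfies the Young-type inequality ∫₀^∞ K₀(p²x)|(f∗g)(x)| dx ≤ (∫₀^∞ K₀(px)|f(x)| dx)·(∫₀^∞ K₀(px)|g(x)| dx). -/
open MeasureTheory Real Set

/-- `K₀(x) = ∫₀^∞ exp(−x cosh u) du`. -/
noncomputable def K0 (x : ℝ) : ℝ := ∫ u in Ioi (0:ℝ), Real.exp (-x * Real.cosh u)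

/-- The Kontorovich–Lebedev convolution. -/
noncomputable def KLconv (f g : ℝ → ℂ) (x : ℝ) : ℂ :=
  (1/(2*x) : ℂ) * ∫ y in Ioi (0:ℝ), ∫ t in Ioi (0:ℝ),
    (Real.exp (-((y^2+t^2)/(2*y*t))*x - y*t/(2*x)) : ℂ) * f y * g t

lemma sq_div_four_le_cosh (u : ℝ) : u ^ 2 / 4 ≤ Real.cosh u := by
  rw [← Real.cosh_abs, Real.cosh_eq]
  have h := Real.quadratic_le_exp_of_nonneg (abs_nonneg u)
  have h' := Real.exp_pos (-|u|)
  have h'' := abs_nonneg u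
  rw [sq_abs] at h
  linarith

lemma integrable_exp_neg_mul_cosh {x : ℝ} (hx : 0 < x) :
    Integrable fun u : ℝ => Real.exp (-x * Real.cosh u) := by
  refine (integrable_exp_neg_mul_sq (b := x / 4) (by positivity)).mono'
    (by fun_prop) (.of_forall fun u => ?_)
  rw [Real.norm_eq_abs, Real.abs_exp, Real.exp_le_exp]
  nlinarith [sq_div_four_le_cosh u]

lemma K0_nonneg (x : ℝ) : 0 ≤ K0 x :=
  integral_nonneg fun _ => (Real.exp_pos _).le

lemma measurable_K0 : Measurable K0 := by
  refine StronglyMeasurable.measurable (StronglyMeasurable.integral_prod_right ?_)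
  exact Measurable.stronglyMeasurable (by unfold Function.uncurry; fun_prop)

lemma ofReal_K0 {x : ℝ} (hx : 0 < x) :
    ENNReal.ofReal (K0 x) =
      ENNReal.ofReal (1 / 2) * ∫⁻ u : ℝ, ENNReal.ofReal (Real.exp (-x * Real.cosh u)) := by
  have h : K0 x = 1 / 2 * ∫ u : ℝ, Real.exp (-x * Real.cosh u) := by
    have := integral_comp_abs (f := fun u => Real.exp (-x * Real.cosh u))
    simp only [Real.cosh_abs] at this
    rw [this, K0]
    ring
  rw [h, ENNReal.ofReal_mul (by norm_num),
    ofReal_integral_eq_lintegral_ofReal (integrable_exp_neg_mul_cosh hx)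
      (.of_forall fun _ => (Real.exp_pos _).le)]

/-- The substitution `x = c e^{-v}` on the half-line. -/
lemma lintegral_Ioi_eq_lintegral_mul_exp_neg {c : ℝ} (hc : 0 < c) (h : ℝ → ENNReal) :
    ∫⁻ x in Ioi (0:ℝ), h x =
      ∫⁻ v : ℝ, ENNReal.ofReal (c * Real.exp (-v)) * h (c * Real.exp (-v)) := by
  have himage : (fun v : ℝ => c * Real.exp (-v)) '' univ = Ioi 0 := by
    ext x
    simp only [image_univ, mem_range, mem_Ioi]
    refine ⟨?_, fun hx => ⟨-Real.log (x / c), ?_⟩⟩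
    · rintro ⟨v, rfl⟩
      positivity
    · rw [neg_neg, Real.exp_log (by positivity)]
      field_simp
  have hderiv : ∀ v ∈ univ, HasDerivWithinAt (fun v : ℝ => c * Real.exp (-v))
      (-(c * Real.exp (-v))) univ v := fun v _ => by
    simpa using ((hasDerivAt_id v).neg.exp).const_mul c
  have hinj : InjOn (fun v : ℝ => c * Real.exp (-v)) univ := fun a _ b _ hab => by
    simpa [hc.ne'] using hab
  rw [← himage, lintegral_image_eq_lintegral_abs_deriv_mul MeasurableSet.univ hderiv hinj,
    Measure.restrict_univ]
  refine lintegral_congr fun v => ?_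
  rw [abs_neg, abs_of_pos (by positivity)]

/-- The exponent in Macdonald's product formula, after the substitution `x = c e^{-v}`. -/
lemma kernel_exponent_le {p y t : ℝ} (hp0 : 0 < p) (hp1 : p ≤ 1) (hy : 0 < y) (ht : 0 < t)
    (w v x : ℝ) (hx : x = y * t / (p * (y * Real.exp w + t)) * Real.exp (-v)) :
    -(p ^ 2 * x) * Real.cosh w + (-((y ^ 2 + t ^ 2) / (2 * y * t)) * x - y * t / (2 * x)) ≤
      -(p * y) * Real.cosh (w + v) + -(p * t) * Real.cosh v := by
  have hxpos : 0 < x := by rw [hx]; positivity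
  have key : -(p ^ 2 * x) * Real.cosh w
      + (-((y ^ 2 + t ^ 2) / (2 * y * t)) * (p ^ 2 * x) - y * t / (2 * x)) =
      -(p * y) * Real.cosh (w + v) + -(p * t) * Real.cosh v := by
    have ha := Real.exp_pos w
    have hb := Real.exp_pos v
    rw [hx]
    simp only [Real.cosh_eq, neg_add, Real.exp_add, Real.exp_neg]
    generalize Real.exp w = a at *
    generalize Real.exp v = b at *
    field_simp
    ring
  have hnn : 0 ≤ (y ^ 2 + t ^ 2) / (2 * y * t) * x * (1 - p ^ 2) :=
    mul_nonneg (by positivity) (by nlinarith)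
  linarith

/-- A weighted form of Macdonald's product formula for `K₀`; for `p = 1` it is an equality. -/
lemma lintegral_K0_mul_kernel_le {p y t : ℝ} (hp0 : 0 < p) (hp1 : p ≤ 1) (hy : 0 < y)
    (ht : 0 < t) :
    ∫⁻ x in Ioi (0:ℝ), ENNReal.ofReal (K0 (p ^ 2 * x)) * (ENNReal.ofReal (1 / (2 * x)) *
        ENNReal.ofReal (Real.exp (-((y ^ 2 + t ^ 2) / (2 * y * t)) * x - y * t / (2 * x)))) ≤
      ENNReal.ofReal (K0 (p * y)) * ENNReal.ofReal (K0 (p * t)) := by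
  have hinner : ∀ w : ℝ, ∫⁻ x in Ioi (0:ℝ), ENNReal.ofReal (1 / (2 * x)) *
      ENNReal.ofReal (Real.exp (-(p ^ 2 * x) * Real.cosh w +
        (-((y ^ 2 + t ^ 2) / (2 * y * t)) * x - y * t / (2 * x)))) ≤
      ∫⁻ v : ℝ, ENNReal.ofReal (1 / 2) * (ENNReal.ofReal (Real.exp (-(p * y) * Real.cosh (w + v)))
        * ENNReal.ofReal (Real.exp (-(p * t) * Real.cosh v))) := fun w => by
    rw [lintegral_Ioi_eq_lintegral_mul_exp_neg
      (c := y * t / (p * (y * Real.exp w + t))) (by positivity)]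
    refine lintegral_mono fun v => ?_
    dsimp only
    have hc : 0 < y * t / (p * (y * Real.exp w + t)) * Real.exp (-v) := by positivity
    have hexp := kernel_exponent_le hp0 hp1 hy ht w v _ rfl
    generalize y * t / (p * (y * Real.exp w + t)) * Real.exp (-v) = x at hc hexp ⊢
    rw [← mul_assoc, ← ENNReal.ofReal_mul hc.le, ← ENNReal.ofReal_mul (Real.exp_pos _).le,
      ← Real.exp_add, show x * (1 / (2 * x)) = 1 / 2 by field_simp]
    gcongr
  calc
    _ = ∫⁻ x in Ioi (0:ℝ), ENNReal.ofReal (1 / 2) * ∫⁻ w : ℝ, ENNReal.ofReal (1 / (2 * x)) *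
        ENNReal.ofReal (Real.exp (-(p ^ 2 * x) * Real.cosh w +
          (-((y ^ 2 + t ^ 2) / (2 * y * t)) * x - y * t / (2 * x)))) := by
      refine setLIntegral_congr_fun measurableSet_Ioi fun x (hx : 0 < x) => ?_
      rw [ofReal_K0 (by positivity), mul_assoc, ← lintegral_mul_const _ (by fun_prop)]
      congr 1
      refine lintegral_congr fun w => ?_
      rw [Real.exp_add, ENNReal.ofReal_mul (Real.exp_pos _).le]
      ring
    _ = ENNReal.ofReal (1 / 2) * ∫⁻ w : ℝ, ∫⁻ x in Ioi (0:ℝ), ENNReal.ofReal (1 / (2 * x)) *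
        ENNReal.ofReal (Real.exp (-(p ^ 2 * x) * Real.cosh w +
          (-((y ^ 2 + t ^ 2) / (2 * y * t)) * x - y * t / (2 * x)))) := by
      rw [lintegral_const_mul' _ _ ENNReal.ofReal_ne_top, lintegral_lintegral_swap]
      exact Measurable.aemeasurable (by unfold Function.uncurry; fun_prop)
    _ ≤ ENNReal.ofReal (1 / 2) * ∫⁻ w : ℝ, ∫⁻ v : ℝ, ENNReal.ofReal (1 / 2) *
        (ENNReal.ofReal (Real.exp (-(p * y) * Real.cosh (w + v)))
          * ENNReal.ofReal (Real.exp (-(p * t) * Real.cosh v))) := by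
      exact mul_le_mul_right (lintegral_mono hinner) _
    _ = ENNReal.ofReal (1 / 2) * ∫⁻ v : ℝ, ∫⁻ w : ℝ, ENNReal.ofReal (1 / 2) *
        (ENNReal.ofReal (Real.exp (-(p * y) * Real.cosh (w + v)))
          * ENNReal.ofReal (Real.exp (-(p * t) * Real.cosh v))) := by
      rw [lintegral_lintegral_swap]
      exact Measurable.aemeasurable (by unfold Function.uncurry; fun_prop)
    _ = ENNReal.ofReal (1 / 2) * ∫⁻ v : ℝ, ∫⁻ w : ℝ, ENNReal.ofReal (1 / 2) *
        (ENNReal.ofReal (Real.exp (-(p * y) * Real.cosh w))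
          * ENNReal.ofReal (Real.exp (-(p * t) * Real.cosh v))) := by
      congr 1
      refine lintegral_congr fun v => ?_
      exact lintegral_add_right_eq_self (fun w => ENNReal.ofReal (1 / 2) *
        (ENNReal.ofReal (Real.exp (-(p * y) * Real.cosh w))
          * ENNReal.ofReal (Real.exp (-(p * t) * Real.cosh v)))) v
    _ = _ := by
      simp_rw [lintegral_const_mul' _ _ ENNReal.ofReal_ne_top,
        lintegral_mul_const' _ _ ENNReal.ofReal_ne_top]
      rw [lintegral_const_mul _ (by fun_prop), ofReal_K0 (by positivity),
        ofReal_K0 (by positivity)]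
      ring

lemma measurable_KLconv {f g : ℝ → ℂ} (hf : Measurable f) (hg : Measurable g) :
    Measurable (KLconv f g) := by
  unfold KLconv
  refine Measurable.mul (by fun_prop) (StronglyMeasurable.measurable ?_)
  refine StronglyMeasurable.integral_prod_right ?_
  refine StronglyMeasurable.integral_prod_right (f := fun (z : ℝ × ℝ) (t : ℝ) =>
    (Real.exp (-((z.2^2+t^2)/(2*z.2*t))*z.1 - z.2*t/(2*z.1)) : ℂ) * f z.2 * g t) ?_
  exact Measurable.stronglyMeasurable (by unfold Function.uncurry; fun_prop)

lemma enorm_KLconv_le (f g : ℝ → ℂ) {x : ℝ} (hx : 0 < x) :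
    ‖KLconv f g x‖ₑ ≤ ENNReal.ofReal (1 / (2 * x)) * ∫⁻ y in Ioi (0:ℝ), ∫⁻ t in Ioi (0:ℝ),
      ENNReal.ofReal (Real.exp (-((y ^ 2 + t ^ 2) / (2 * y * t)) * x - y * t / (2 * x))) *
        (‖f y‖ₑ * ‖g t‖ₑ) := by
  rw [KLconv, enorm_mul]
  gcongr
  · rw [← ofReal_norm]
    apply le_of_eq
    congr 1
    simp [abs_of_pos hx]
  · refine (enorm_integral_le_lintegral_enorm _).trans (lintegral_mono fun y => ?_)
    refine (enorm_integral_le_lintegral_enorm _).trans (lintegral_mono fun t => le_of_eq ?_)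
    rw [enorm_mul, enorm_mul, mul_assoc, ← ofReal_norm (Complex.ofReal _),
      Complex.norm_real, Real.norm_eq_abs, Real.abs_exp]

lemma ofReal_K0_mul_norm (a : ℝ) (z : ℂ) :
    ENNReal.ofReal (K0 a * ‖z‖) = ENNReal.ofReal (K0 a) * ‖z‖ₑ := by
  rw [ENNReal.ofReal_mul (K0_nonneg a), ofReal_norm]

lemma lintegral_K0_mul_enorm_KLconv_le {p : ℝ} (hp0 : 0 < p) (hp1 : p ≤ 1) {f g : ℝ → ℂ}
    (hf : Measurable f) (hg : Measurable g) :
    ∫⁻ x in Ioi (0:ℝ), ENNReal.ofReal (K0 (p ^ 2 * x)) * ‖KLconv f g x‖ₑ ≤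
      (∫⁻ y in Ioi (0:ℝ), ENNReal.ofReal (K0 (p * y)) * ‖f y‖ₑ) *
        ∫⁻ t in Ioi (0:ℝ), ENNReal.ofReal (K0 (p * t)) * ‖g t‖ₑ := by
  have hK := measurable_K0
  set H : ℝ → ℝ → ℝ → ENNReal := fun x y t =>
    ENNReal.ofReal (K0 (p ^ 2 * x)) * (ENNReal.ofReal (1 / (2 * x)) *
      ENNReal.ofReal (Real.exp (-((y ^ 2 + t ^ 2) / (2 * y * t)) * x - y * t / (2 * x)))) with hH
  calc
    _ ≤ ∫⁻ x in Ioi (0:ℝ), ∫⁻ y in Ioi (0:ℝ), ∫⁻ t in Ioi (0:ℝ),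
        H x y t * (‖f y‖ₑ * ‖g t‖ₑ) := by
      refine setLIntegral_mono' measurableSet_Ioi fun x hx => ?_
      simp_rw [hH, mul_assoc (ENNReal.ofReal _), lintegral_const_mul' _ _ ENNReal.ofReal_ne_top]
      gcongr
      exact enorm_KLconv_le f g hx
    _ = ∫⁻ y in Ioi (0:ℝ), ∫⁻ x in Ioi (0:ℝ), ∫⁻ t in Ioi (0:ℝ),
        H x y t * (‖f y‖ₑ * ‖g t‖ₑ) := by
      refine lintegral_lintegral_swap (Measurable.aemeasurable ?_)
      refine Measurable.lintegral_prod_right (f := fun (z : ℝ × ℝ) (t : ℝ) =>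
        H z.1 z.2 t * (‖f z.2‖ₑ * ‖g t‖ₑ)) ?_
      unfold Function.uncurry
      fun_prop
    _ = ∫⁻ y in Ioi (0:ℝ), ∫⁻ t in Ioi (0:ℝ), ∫⁻ x in Ioi (0:ℝ),
        H x y t * (‖f y‖ₑ * ‖g t‖ₑ) := by
      refine lintegral_congr fun y => lintegral_lintegral_swap (Measurable.aemeasurable ?_)
      unfold Function.uncurry
      fun_prop
    _ ≤ ∫⁻ y in Ioi (0:ℝ), ∫⁻ t in Ioi (0:ℝ), (ENNReal.ofReal (K0 (p * y)) * ‖f y‖ₑ) *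
        (ENNReal.ofReal (K0 (p * t)) * ‖g t‖ₑ) := by
      refine setLIntegral_mono' measurableSet_Ioi fun y hy =>
        setLIntegral_mono' measurableSet_Ioi fun t ht => ?_
      rw [lintegral_mul_const' _ _ (ENNReal.mul_ne_top enorm_ne_top enorm_ne_top),
        mul_mul_mul_comm]
      gcongr
      exact lintegral_K0_mul_kernel_le hp0 hp1 hy ht
    _ = _ := lintegral_lintegral_mul (by fun_prop) (by fun_prop)

theorem KL_conv_young (p : ℝ) (hp0 : 0 < p) (hp1 : p ≤ 1) (f g : ℝ → ℂ)
    (hfm : Measurable f) (hgm : Measurable g)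
    (hf : IntegrableOn (fun x => K0 (p*x) * ‖f x‖) (Ioi 0))
    (hg : IntegrableOn (fun x => K0 (p*x) * ‖g x‖) (Ioi 0)) :
    IntegrableOn (fun x => K0 (p^2*x) * ‖KLconv f g x‖) (Ioi 0) ∧
    ∫ x in Ioi (0:ℝ), K0 (p^2*x) * ‖KLconv f g x‖ ≤
      (∫ x in Ioi (0:ℝ), K0 (p*x) * ‖f x‖) * (∫ x in Ioi (0:ℝ), K0 (p*x) * ‖g x‖) := by
  have hK := measurable_K0
  have hC := measurable_KLconv hfm hgm
  have hmain := lintegral_K0_mul_enorm_KLconv_le hp0 hp1 hfm hgm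
  simp_rw [← ofReal_K0_mul_norm] at hmain
  have hnn : ∀ (c : ℝ) (h : ℝ → ℂ) (x : ℝ), 0 ≤ K0 (c * x) * ‖h x‖ := fun c h x =>
    mul_nonneg (K0_nonneg _) (norm_nonneg _)
  rw [← ofReal_integral_eq_lintegral_ofReal hf (.of_forall (hnn p f)),
    ← ofReal_integral_eq_lintegral_ofReal hg (.of_forall (hnn p g)),
    ← ENNReal.ofReal_mul (integral_nonneg (hnn p f))] at hmain
  have hint : IntegrableOn (fun x => K0 (p^2*x) * ‖KLconv f g x‖) (Ioi 0) :=
    (lintegral_ofReal_ne_top_iff_integrable (Measurable.aestronglyMeasurable (by fun_prop))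
      (.of_forall (hnn (p ^ 2) _))).1 (ne_top_of_le_ne_top ENNReal.ofReal_ne_top hmain)
  refine ⟨hint, ?_⟩
  rwa [← ofReal_integral_eq_lintegral_ofReal hint (.of_forall (hnn (p ^ 2) _)),
    ENNReal.ofReal_le_ofReal_iff
      (mul_nonneg (integral_nonneg (hnn p f)) (integral_nonneg (hnn p g)))] at hmain
end

section
/- Let 0 < p ≤ 1 and let f : (0,∞) → ℂ be measurable with ∫₀^∞ K₀(px)·|f(x)|·x⁻¹ dx < ∞, and set g(x) = f(x)/x. Then for every τ > 0 the Kontorovich–Lebedev transform of g equals the composition of the Fourier cosine and Laplace transforms: (Fg)(τ) = ∫₀^∞ cos(τu) · (∫₀^∞ exp(−x·cosh u)·f(x)·x⁻¹ dx) du. -/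
open MeasureTheory Real Set

/-- `K_{iτ}(x) = ∫₀^∞ exp(−x cosh u) cos(τu) du`. -/
noncomputable def Kib (τ x : ℝ) : ℝ :=
  ∫ u in Ioi (0:ℝ), Real.exp (-x * Real.cosh u) * Real.cos (τ * u)

/-- The Kontorovich–Lebedev transform. -/
noncomputable def KL (f : ℝ → ℂ) (τ : ℝ) : ℂ := ∫ x in Ioi (0:ℝ), (Kib τ x : ℂ) * f x

/-- The integrand defining `K₀` is integrable for positive argument. -/
theorem integrableOn_exp_neg_mul_cosh {x : ℝ} (hx : 0 < x) :
    IntegrableOn (fun u => Real.exp (-x * Real.cosh u)) (Ioi 0) := by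
  refine (exp_neg_integrableOn_Ioi 0 hx).mono' (by fun_prop) ?_
  filter_upwards [ae_restrict_mem measurableSet_Ioi] with u hu
  have hu' : u ≤ Real.cosh u :=
    (Real.self_le_sinh_iff.2 (le_of_lt hu)).trans (Real.sinh_lt_cosh u).le
  rw [Real.norm_of_nonneg (Real.exp_pos _).le, Real.exp_le_exp]
  nlinarith

/-- Integrability of `K₀(px) |f(x)| / x` gives joint integrability of its integral kernel. -/
theorem integrable_prod_exp_neg_mul_cosh {p : ℝ} (hp0 : 0 < p) {f : ℝ → ℂ} (hfm : Measurable f)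
    (hf : IntegrableOn (fun x => K0 (p * x) * ‖f x‖ / x) (Ioi 0)) :
    Integrable (fun z : ℝ × ℝ => Real.exp (-(p * z.1) * Real.cosh z.2) * (‖f z.1‖ / z.1))
      ((volume.restrict (Ioi 0)).prod (volume.restrict (Ioi 0))) := by
  have hm : Measurable
      (fun z : ℝ × ℝ => Real.exp (-(p * z.1) * Real.cosh z.2) * (‖f z.1‖ / z.1)) := by
    fun_prop
  refine (integrable_prod_iff hm.aestronglyMeasurable).2 ⟨?_, ?_⟩
  · filter_upwards [ae_restrict_mem measurableSet_Ioi] with x hx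
    exact (integrableOn_exp_neg_mul_cosh (mul_pos hp0 hx)).mul_const _
  · refine hf.congr ?_
    filter_upwards [ae_restrict_mem measurableSet_Ioi] with x hx
    have hx' : 0 ≤ ‖f x‖ / x := div_nonneg (norm_nonneg _) (le_of_lt hx)
    simp only [norm_mul, Real.norm_of_nonneg (Real.exp_pos _).le, Real.norm_of_nonneg hx']
    rw [integral_mul_const, K0, mul_div_assoc]

theorem KL_eq_cos_laplace (p : ℝ) (hp0 : 0 < p) (hp1 : p ≤ 1) (f : ℝ → ℂ)
    (hfm : Measurable f)
    (hf : IntegrableOn (fun x => K0 (p*x) * ‖f x‖ / x) (Ioi 0)) :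
    ∀ τ : ℝ, 0 < τ →
      KL (fun x => f x / x) τ =
        ∫ u in Ioi (0:ℝ), (Real.cos (τ*u) : ℂ) *
          ∫ x in Ioi (0:ℝ), (Real.exp (-x * Real.cosh u) : ℂ) * f x / x := by
  intro τ _
  have hm : Measurable (fun z : ℝ × ℝ =>
      ((Real.exp (-z.1 * Real.cosh z.2) * Real.cos (τ * z.2) : ℝ) : ℂ) * (f z.1 / z.1)) := by
    fun_prop
  have hint : Integrable (fun z : ℝ × ℝ =>
      ((Real.exp (-z.1 * Real.cosh z.2) * Real.cos (τ * z.2) : ℝ) : ℂ) * (f z.1 / z.1))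
      ((volume.restrict (Ioi 0)).prod (volume.restrict (Ioi 0))) := by
    refine (integrable_prod_exp_neg_mul_cosh hp0 hfm hf).mono' hm.aestronglyMeasurable ?_
    rw [Measure.prod_restrict]
    filter_upwards [ae_restrict_mem (measurableSet_Ioi.prod measurableSet_Ioi)] with z hz
    have hx : 0 < z.1 := hz.1
    rw [norm_mul, norm_div, Complex.norm_real, Complex.norm_real, norm_mul,
      Real.norm_of_nonneg hx.le, Real.norm_of_nonneg (Real.exp_pos _).le]
    gcongr
    calc Real.exp (-z.1 * Real.cosh z.2) * ‖Real.cos (τ * z.2)‖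
        ≤ Real.exp (-z.1 * Real.cosh z.2) :=
          mul_le_of_le_one_right (Real.exp_pos _).le (Real.abs_cos_le_one _)
      _ ≤ Real.exp (-(p * z.1) * Real.cosh z.2) := by
          gcongr
          exact mul_le_of_le_one_left hx.le hp1
  calc KL (fun x => f x / x) τ
      = ∫ x in Ioi (0:ℝ), ∫ u in Ioi (0:ℝ),
          ((Real.exp (-x * Real.cosh u) * Real.cos (τ * u) : ℝ) : ℂ) * (f x / x) := by
        simp only [KL, Kib, integral_mul_const, integral_complex_ofReal]
    _ = ∫ u in Ioi (0:ℝ), ∫ x in Ioi (0:ℝ),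
          ((Real.exp (-x * Real.cosh u) * Real.cos (τ * u) : ℝ) : ℂ) * (f x / x) :=
        integral_integral_swap hint
    _ = _ := by
        congr 1 with u
        rw [← integral_const_mul]
        congr 1 with x
        push_cast
        ring
end

section
/- Let p ∈ (0,1), r > 1, a > 1, and let f : (0,∞) → ℂ be measurable with ∫₀^∞ K₀(px)·|f(x)|^r·x^{−a} dx < ∞. Then lim_{u→∞} sinh(u) · ∫₀^∞ exp(−x·cosh u)·f(x) dx = 0. -/
open MeasureTheory Real Set Filter

lemma Real.le_cosh (u : ℝ) : u ≤ Real.cosh u := by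
  rcases le_total 0 u with h | h
  · exact (Real.self_le_sinh_iff.2 h).trans (Real.sinh_lt_cosh u).le
  · exact h.trans (Real.cosh_pos u).le

/-- Lower bound for `K₀`, from restricting the defining integral to `0 < u ≤ 1`. -/
lemma exp_neg_two_mul_le_K0 {y : ℝ} (hy : 0 < y) : Real.exp (-(2 * y)) ≤ K0 y := by
  have hint : IntegrableOn (fun u => Real.exp (-y * Real.cosh u)) (Ioi 0) := by
    refine Integrable.mono' (g := fun u => Real.exp (-y * u))
      (exp_neg_integrableOn_Ioi 0 hy) (by fun_prop) ?_
    refine Eventually.of_forall fun u => ?_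
    rw [Real.norm_eq_abs, Real.abs_exp, Real.exp_le_exp]
    nlinarith [Real.le_cosh u]
  have hcosh : Real.cosh 1 ≤ 2 := by
    have h1 := Real.cosh_le_exp_half_sq 1
    have h2 : Real.exp (1 ^ 2 / 2) ^ 2 = Real.exp 1 := by
      rw [← Real.exp_nat_mul]; norm_num
    have h3 := Real.exp_one_lt_d9
    nlinarith [Real.exp_pos (1 ^ 2 / 2)]
  calc Real.exp (-(2 * y)) = ∫ _ in Ioc (0:ℝ) 1, Real.exp (-(2 * y)) := by simp
    _ ≤ ∫ u in Ioc (0:ℝ) 1, Real.exp (-y * Real.cosh u) := by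
        refine setIntegral_mono_on (by simp) (hint.mono_set Ioc_subset_Ioi_self)
          measurableSet_Ioc fun u hu => ?_
        have : Real.cosh u ≤ Real.cosh 1 := by
          rw [Real.cosh_le_cosh, abs_of_pos hu.1, abs_one]; exact hu.2
        rw [Real.exp_le_exp]
        nlinarith
    _ ≤ K0 y := setIntegral_mono_set hint (Eventually.of_forall fun u => (Real.exp_pos _).le)
        Ioc_subset_Ioi_self.eventuallyLE

/-- The exponential dominates every power. -/
lemma rpow_le_rpow_self_mul_exp {b x : ℝ} (hb : 0 < b) (hx : 0 < x) :
    x ^ b ≤ b ^ b * Real.exp x := by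
  have h : x ≤ b * Real.exp (x / b) := by
    have h1 := Real.add_one_le_exp (x / b)
    have h2 : b * (x / b) = x := by field_simp
    nlinarith
  calc x ^ b ≤ (b * Real.exp (x / b)) ^ b := Real.rpow_le_rpow hx.le h hb.le
    _ = b ^ b * Real.exp x := by
      rw [Real.mul_rpow hb.le (Real.exp_pos _).le, ← Real.exp_mul, div_mul_cancel₀ _ hb.ne']

lemma mul_exp_mul_rpow_le_K0 {p a c x : ℝ} (hp0 : 0 < p) (hp1 : p < 1) (ha : 1 < a)
    (hc : 6 ≤ c) (hx : 0 < x) :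
    c * Real.exp (-x * c) * x ^ a ≤ 2 * (a - 1) ^ (a - 1) * K0 (p * x) := by
  have hpow : x ^ a = x * x ^ (a - 1) := by
    rw [Real.rpow_sub_one hx.ne']; field_simp
  have h1 : c * x ≤ 2 * Real.exp (c * x / 2) := by
    linarith [Real.add_one_le_exp (c * x / 2)]
  have h2 := rpow_le_rpow_self_mul_exp (sub_pos.2 ha) hx
  have h3 : Real.exp (c * x / 2) * Real.exp x * Real.exp (-x * c) ≤ K0 (p * x) := by
    refine le_trans ?_ (exp_neg_two_mul_le_K0 (mul_pos hp0 hx))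
    rw [← Real.exp_add, ← Real.exp_add, Real.exp_le_exp]
    nlinarith
  have hM : 0 ≤ (a - 1) ^ (a - 1) := Real.rpow_nonneg (sub_pos.2 ha).le _
  calc c * Real.exp (-x * c) * x ^ a = (c * x) * x ^ (a - 1) * Real.exp (-x * c) := by
        rw [hpow]; ring
    _ ≤ (2 * Real.exp (c * x / 2)) * ((a - 1) ^ (a - 1) * Real.exp x) * Real.exp (-x * c) := by
        gcongr
    _ = 2 * (a - 1) ^ (a - 1) * (Real.exp (c * x / 2) * Real.exp x * Real.exp (-x * c)) := by
        ring
    _ ≤ _ := by gcongr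

lemma le_add_rpow_mul_rpow {δ t r : ℝ} (hδ : 0 < δ) (ht : 0 ≤ t) (hr : 1 < r) :
    t ≤ δ + δ ^ (1 - r) * t ^ r := by
  have hpos : 0 ≤ δ ^ (1 - r) * t ^ r := by positivity
  rcases le_total t δ with h | h
  · linarith
  have ht' : 0 < t := hδ.trans_le h
  have : t ^ (1 - r) ≤ δ ^ (1 - r) :=
    Real.rpow_le_rpow_of_nonpos hδ h (by linarith)
  calc t = t ^ (1 - r) * t ^ r := by rw [← Real.rpow_add ht']; simp
    _ ≤ δ ^ (1 - r) * t ^ r := by gcongr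
    _ ≤ _ := by linarith

section Kernel

variable {p r a : ℝ} {f : ℝ → ℂ}

lemma norm_mul_exp_mul_rpow_le (hp0 : 0 < p) (hp1 : p < 1) (ha : 1 < a)
    {c x : ℝ} (hc : 6 ≤ c) (hx : 0 < x) :
    ‖c * Real.exp (-x * c) * ‖f x‖ ^ r‖ ≤
      2 * (a - 1) ^ (a - 1) * (K0 (p * x) * ‖f x‖ ^ r / x ^ a) := by
  have hxa : 0 < x ^ a := Real.rpow_pos_of_pos hx a
  have hc0 : 0 ≤ c := by linarith
  rw [Real.norm_of_nonneg (by positivity), ← mul_div_assoc, le_div_iff₀ hxa]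
  have := mul_le_mul_of_nonneg_right (mul_exp_mul_rpow_le_K0 hp0 hp1 ha hc hx)
    (Real.rpow_nonneg (norm_nonneg (f x)) r)
  linarith

lemma integrableOn_mul_exp_mul_rpow (hp0 : 0 < p) (hp1 : p < 1) (ha : 1 < a)
    (hfm : Measurable f)
    (hfr : IntegrableOn (fun x => K0 (p*x) * ‖f x‖ ^ r / x ^ a) (Ioi 0)) {c : ℝ} (hc : 6 ≤ c) :
    IntegrableOn (fun x => c * Real.exp (-x * c) * ‖f x‖ ^ r) (Ioi 0) :=
  (hfr.const_mul (2 * (a - 1) ^ (a - 1))).mono'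
    (Measurable.aestronglyMeasurable (by fun_prop))
    ((ae_restrict_mem measurableSet_Ioi).mono fun _ hx =>
      norm_mul_exp_mul_rpow_le hp0 hp1 ha hc hx)

lemma tendsto_integral_mul_exp_mul_rpow (hp0 : 0 < p) (hp1 : p < 1) (ha : 1 < a)
    (hfm : Measurable f)
    (hfr : IntegrableOn (fun x => K0 (p*x) * ‖f x‖ ^ r / x ^ a) (Ioi 0)) :
    Tendsto (fun c : ℝ => ∫ x in Ioi (0:ℝ), c * Real.exp (-x * c) * ‖f x‖ ^ r)
      atTop (nhds 0) := by
  suffices h : Tendsto (fun c : ℝ => ∫ x in Ioi (0:ℝ), c * Real.exp (-x * c) * ‖f x‖ ^ r)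
      atTop (nhds (∫ _ in Ioi (0:ℝ), (0:ℝ))) by simpa using h
  refine tendsto_integral_filter_of_dominated_convergence _
    (Eventually.of_forall fun c => Measurable.aestronglyMeasurable (by fun_prop))
    ((eventually_ge_atTop 6).mono fun c hc => (ae_restrict_mem measurableSet_Ioi).mono
      fun x hx => norm_mul_exp_mul_rpow_le hp0 hp1 ha hc hx)
    (hfr.const_mul (2 * (a - 1) ^ (a - 1)))
    ((ae_restrict_mem measurableSet_Ioi).mono fun x hx => ?_)
  have h := (tendsto_rpow_mul_exp_neg_mul_atTop_nhds_zero 1 x hx).mul_const (‖f x‖ ^ r)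
  simpa using h

lemma norm_sinh_mul_integral_le (hp0 : 0 < p) (hp1 : p < 1) (hr : 1 < r) (ha : 1 < a)
    (hfm : Measurable f)
    (hfr : IntegrableOn (fun x => K0 (p*x) * ‖f x‖ ^ r / x ^ a) (Ioi 0))
    {δ u : ℝ} (hδ : 0 < δ) (hu : 6 ≤ Real.cosh u) :
    ‖((Real.sinh u : ℝ) : ℂ) * ∫ x in Ioi (0:ℝ), (Real.exp (-x * Real.cosh u) : ℂ) * f x‖ ≤
      δ + δ ^ (1 - r) *
        ∫ x in Ioi (0:ℝ), Real.cosh u * Real.exp (-x * Real.cosh u) * ‖f x‖ ^ r := by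
  set c := Real.cosh u
  have hc0 : 0 < c := by linarith
  have hexp : IntegrableOn (fun x => c * Real.exp (-x * c)) (Ioi 0) := by
    have := (exp_neg_integrableOn_Ioi 0 hc0).const_mul c
    simpa [IntegrableOn, mul_comm] using this
  have hone : ∫ x in Ioi (0:ℝ), c * Real.exp (-x * c) = 1 := by
    have := integral_exp_mul_Ioi (neg_lt_zero.2 hc0) 0
    rw [integral_const_mul]
    simp_rw [neg_mul, mul_comm c] at this
    simp_rw [neg_mul, this]
    simp [hc0.ne']
  have hint := integrableOn_mul_exp_mul_rpow hp0 hp1 ha hfm hfr hu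
  have hsinh : |Real.sinh u| ≤ c := abs_le_of_sq_le_sq
    (by have := Real.cosh_sq u; simp only [c]; linarith) hc0.le
  have hnorm : ∀ x, ‖((Real.sinh u : ℝ) : ℂ) * ((Real.exp (-x * c) : ℂ) * f x)‖ ≤
      δ * (c * Real.exp (-x * c)) + δ ^ (1 - r) * (c * Real.exp (-x * c) * ‖f x‖ ^ r) := by
    intro x
    rw [norm_mul, norm_mul, Complex.norm_real, Complex.norm_real, Real.norm_eq_abs,
      Real.norm_eq_abs, Real.abs_exp]
    calc |Real.sinh u| * (Real.exp (-x * c) * ‖f x‖)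
        ≤ c * (Real.exp (-x * c) * (δ + δ ^ (1 - r) * ‖f x‖ ^ r)) := by
          gcongr
          exact le_add_rpow_mul_rpow hδ (norm_nonneg _) hr
      _ = _ := by ring
  rw [← integral_const_mul]
  refine (norm_integral_le_of_norm_le ((hexp.const_mul δ).add (hint.const_mul (δ ^ (1 - r))))
    (Eventually.of_forall hnorm)).trans_eq ?_
  simp only [Pi.add_apply]
  rw [integral_add (hexp.const_mul δ) (hint.const_mul _), integral_const_mul δ,
    integral_const_mul (δ ^ (1 - r)), hone, mul_one]

end Kernel

theorem laplace_decay (p r a : ℝ) (hp0 : 0 < p) (hp1 : p < 1) (hr : 1 < r) (ha : 1 < a)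
    (f : ℝ → ℂ) (hfm : Measurable f)
    (hfr : IntegrableOn (fun x => K0 (p*x) * ‖f x‖ ^ r / x ^ a) (Ioi 0)) :
    Tendsto (fun u : ℝ => ((Real.sinh u : ℝ) : ℂ) *
        ∫ x in Ioi (0:ℝ), (Real.exp (-x * Real.cosh u) : ℂ) * f x)
      atTop (nhds 0) := by
  have hcosh : Tendsto Real.cosh atTop atTop := tendsto_atTop_mono Real.le_cosh tendsto_id
  have hlim := (tendsto_integral_mul_exp_mul_rpow hp0 hp1 ha hfm hfr).comp hcosh
  rw [tendsto_zero_iff_norm_tendsto_zero, Metric.tendsto_nhds]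
  intro ε hε
  have hδ : 0 < ε / 2 := half_pos hε
  have hlim' := hlim.const_mul ((ε / 2) ^ (1 - r))
  rw [mul_zero] at hlim'
  filter_upwards [hcosh.eventually_ge_atTop 6, hlim'.eventually_lt_const hδ] with u hu hsmall
  rw [dist_zero_right, norm_norm]
  refine (norm_sinh_mul_integral_le hp0 hp1 hr ha hfm hfr hδ hu).trans_lt ?_
  simp only [Function.comp_apply] at hsmall
  linarith
end
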